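/- arXiv:1012.4891 — 4 statements merged into one kernel-verified Lean document; each statement's English description precedes it below -/
import Mathlib

section
/- For all terms s and t, if g(s) =_{E₁} g(t) then s =_{E₁} t. -/
/-- Terms built from a countable set of variables, two free constants `b` and
`c`, a constant `1` (`one`), binary symbols `mul` (*), `cmul` (⊛) and `exp`,
and unary symbols `inv` (⁻¹), `iinv` (i) and `g`. -/
inductive Tm : Type
  | var : ℕ → Tm
  | b : Tm
  | c : Tm
  | one : Tm
  | mul : Tm → Tm → Tm
  | cmul : Tm → Tm → Tm
  | exp : Tm → Tm → Tm
  | inv : Tm → Tm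
  | iinv : Tm → Tm
  | g : Tm → Tm

/-- The equational theory E₁: the smallest congruence on terms, closed under
substitution (hence the axioms are stated for arbitrary terms), generated by
associativity and commutativity of `*` and `⊛`, the abelian group axioms for
`(*, ⁻¹, 1)` and `(⊛, i, 1)`, and the exponentiation axioms `exp(X,1) = X`,
`exp(1,Z) = 1`, `exp(X⁻¹,Z) = exp(X,Z)⁻¹`, `exp(g(X),Y) = g(X ⊛ Y)`, and
`exp(X*Y,Z) = exp(X,Z) * exp(Y,Z)`. -/
inductive E1 : Tm → Tm → Prop
  | mul_assoc (x y z : Tm) : E1 (.mul (.mul x y) z) (.mul x (.mul y z))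
  | mul_comm (x y : Tm) : E1 (.mul x y) (.mul y x)
  | cmul_assoc (x y z : Tm) : E1 (.cmul (.cmul x y) z) (.cmul x (.cmul y z))
  | cmul_comm (x y : Tm) : E1 (.cmul x y) (.cmul y x)
  | mul_inv (x : Tm) : E1 (.mul x (.inv x)) .one
  | mul_one (x : Tm) : E1 (.mul x .one) x
  | cmul_iinv (x : Tm) : E1 (.cmul x (.iinv x)) .one
  | cmul_one (x : Tm) : E1 (.cmul x .one) x
  | exp_one (x : Tm) : E1 (.exp x .one) x
  | one_exp (z : Tm) : E1 (.exp .one z) .one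
  | exp_inv (x z : Tm) : E1 (.exp (.inv x) z) (.inv (.exp x z))
  | exp_g (x y : Tm) : E1 (.exp (.g x) y) (.g (.cmul x y))
  | exp_mul (x y z : Tm) : E1 (.exp (.mul x y) z) (.mul (.exp x z) (.exp y z))
  | refl (t : Tm) : E1 t t
  | symm {s t : Tm} : E1 s t → E1 t s
  | trans {s t u : Tm} : E1 s t → E1 t u → E1 s u
  | mul_congr {s t u v : Tm} : E1 s t → E1 u v → E1 (.mul s u) (.mul t v)
  | cmul_congr {s t u v : Tm} : E1 s t → E1 u v → E1 (.cmul s u) (.cmul t v)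
  | exp_congr {s t u v : Tm} : E1 s t → E1 u v → E1 (.exp s u) (.exp t v)
  | inv_congr {s t : Tm} : E1 s t → E1 (.inv s) (.inv t)
  | iinv_congr {s t : Tm} : E1 s t → E1 (.iinv s) (.iinv t)
  | g_congr {s t : Tm} : E1 s t → E1 (.g s) (.g t)

/-- `u ⊛ u ⊛ ⋯ ⊛ u` (`n` factors); the empty product is `1`. -/
def cpow (u : Tm) : ℕ → Tm
  | 0 => .one
  | 1 => u
  | n + 2 => .cmul u (cpow u (n + 1))

/-- `⊙ₙ(u)`: the term `u ⊛ ⋯ ⊛ u` (`n` factors) if `n > 0`, the term `1` if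
`n = 0`, and `i(u) ⊛ ⋯ ⊛ i(u)` (`|n|` factors) if `n < 0`. -/
def odot (n : ℤ) (u : Tm) : Tm :=
  if 0 < n then cpow u n.toNat else cpow (.iinv u) (-n).toNat

/-- A ground term contains no variables. -/
def Tm.Ground : Tm → Prop
  | .var _ => False
  | .b => True
  | .c => True
  | .one => True
  | .mul s t => s.Ground ∧ t.Ground
  | .cmul s t => s.Ground ∧ t.Ground
  | .exp s t => s.Ground ∧ t.Ground
  | .inv t => t.Ground
  | .iinv t => t.Ground
  | .g t => t.Ground

/-- Moving a factor of `⊛` to the other side of an equation modulo `E1`. -/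
theorem E1.cmul_left_iff (x y z : Tm) :
    E1 (.cmul x y) z ↔ E1 x (.cmul z (.iinv y)) := by
  constructor
  · intro h
    have h₁ : E1 (.cmul (.cmul x y) (.iinv y)) x :=
      (E1.cmul_assoc _ _ _).trans
        (((E1.refl x).cmul_congr (E1.cmul_iinv y)).trans (E1.cmul_one x))
    exact h₁.symm.trans (h.cmul_congr (E1.refl _))
  · intro h
    have h₁ : E1 (.cmul (.cmul z (.iinv y)) y) z :=
      (E1.cmul_assoc _ _ _).trans
        (((E1.refl z).cmul_congr ((E1.cmul_comm _ _).trans (E1.cmul_iinv y))).trans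
          (E1.cmul_one z))
    exact (h.cmul_congr (E1.refl y)).trans h₁

theorem E1.cmul_iinv_one (z : Tm) : E1 (.cmul z (.iinv .one)) z :=
  ((E1.cmul_left_iff z .one z).1 (E1.cmul_one z)).symm

open Classical in
/-- The signed multiplicity with which `g(z)`, taken modulo `E1`, occurs in a term. Exponentiation
acts by translation in `z`. -/
noncomputable def Tm.gCount : Tm → Tm → ℤ
  | .var _, _ => 0
  | .b, _ => 0
  | .c, _ => 0
  | .one, _ => 0
  | .mul s t, z => s.gCount z + t.gCount z
  | .cmul s t, z => s.gCount z + t.gCount z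
  | .exp s t, z => s.gCount (.cmul z (.iinv t))
  | .inv t, z => -t.gCount z
  | .iinv t, z => -t.gCount z
  | .g t, z => if E1 t z then 1 else 0

theorem Tm.gCount_g_congr {s t z z' : Tm} (h : E1 s z ↔ E1 t z') :
    (Tm.g s).gCount z = (Tm.g t).gCount z' := by
  simp only [gCount]
  by_cases hz : E1 t z' <;> simp [h, hz]

theorem Tm.gCount_congr_right (s : Tm) {z z' : Tm} (h : E1 z z') :
    s.gCount z = s.gCount z' := by
  induction s generalizing z z' with
  | var | b | c | one => rfl
  | mul s t hs ht | cmul s t hs ht => simp only [gCount, hs h, ht h]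
  | exp s t hs _ => exact hs (h.cmul_congr (E1.refl _))
  | inv t ht | iinv t ht => simp only [gCount, ht h]
  | g t _ =>
    have : E1 t z ↔ E1 t z' := ⟨fun k => k.trans h, fun k => k.trans h.symm⟩
    exact Tm.gCount_g_congr this

theorem E1.gCount_eq {s t : Tm} (h : E1 s t) (z : Tm) : s.gCount z = t.gCount z := by
  induction h generalizing z with
  | mul_assoc | cmul_assoc => simp only [Tm.gCount, add_assoc]
  | mul_comm | cmul_comm => simp only [Tm.gCount, add_comm]
  | mul_inv | cmul_iinv | mul_one | cmul_one | one_exp | exp_inv | exp_mul =>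
    simp [Tm.gCount]
  | exp_one x => exact x.gCount_congr_right (E1.cmul_iinv_one z)
  | exp_g x y => exact Tm.gCount_g_congr (E1.cmul_left_iff x y z).symm
  | refl => rfl
  | symm _ ih => exact (ih z).symm
  | trans _ _ ih₁ ih₂ => exact (ih₁ z).trans (ih₂ z)
  | mul_congr _ _ ih₁ ih₂ | cmul_congr _ _ ih₁ ih₂ => simp only [Tm.gCount, ih₁, ih₂]
  | @exp_congr s t u v _ h₂ ih₁ _ =>
    simp only [Tm.gCount, ih₁]
    exact t.gCount_congr_right ((E1.refl z).cmul_congr h₂.iinv_congr)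
  | inv_congr _ ih | iinv_congr _ ih => simp only [Tm.gCount, ih]
  | @g_congr s t h _ =>
    have : E1 s z ↔ E1 t z := ⟨h.symm.trans, h.trans⟩
    exact Tm.gCount_g_congr this

/-- If `g(s) =_{E₁} g(t)` then `s =_{E₁} t`. -/
theorem g_injective_mod_E1 (s t : Tm) (h : E1 (.g s) (.g t)) : E1 s t := by
  have key := h.gCount_eq t
  by_contra hst
  simp [Tm.gCount, hst, E1.refl t] at key
end

section
/- For all integers m and n, there exists a term t such that t * g(⊙ₙ(b)) =_{E₁} exp(t, b) * g(⊙ₘ(b)). -/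
/-- The setoid on terms given by the equational theory `E1`. -/
def E1.setoid : Setoid Tm := ⟨E1, E1.refl, E1.symm, E1.trans⟩

/-- The terms modulo `E1`. -/
abbrev E1Quotient : Type := Quotient E1.setoid

instance : Mul E1Quotient := ⟨Quotient.map₂ Tm.mul fun _ _ h _ _ h' => E1.mul_congr h h'⟩

instance : Inv E1Quotient := ⟨Quotient.map Tm.inv fun _ _ h => E1.inv_congr h⟩

instance : One E1Quotient := ⟨Quotient.mk _ Tm.one⟩

instance : CommGroup E1Quotient :=
  { Group.ofRightAxioms (G := E1Quotient)
      (by rintro ⟨x⟩ ⟨y⟩ ⟨z⟩; exact Quotient.sound (E1.mul_assoc x y z))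
      (by rintro ⟨x⟩; exact Quotient.sound (E1.mul_one x))
      (by rintro ⟨x⟩; exact Quotient.sound (E1.mul_inv x)) with
    mul_comm := by rintro ⟨x⟩ ⟨y⟩; exact Quotient.sound (E1.mul_comm x y) }

/-- Exponentiation by a fixed term, as an endomorphism of the group of terms modulo `E1`. -/
def E1Quotient.expHom (z : Tm) : E1Quotient →* E1Quotient where
  toFun := Quotient.map (Tm.exp · z) fun _ _ h => E1.exp_congr h (E1.refl z)
  map_one' := Quotient.sound (E1.one_exp z)
  map_mul' := by rintro ⟨x⟩ ⟨y⟩; exact Quotient.sound (E1.exp_mul x y z)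

theorem E1.cpow_cmul (u : Tm) : ∀ n : ℕ, E1 (.cmul (cpow u n) u) (cpow u (n + 1))
  | 0 => (E1.cmul_comm _ _).trans (E1.cmul_one u)
  | _ + 1 => E1.cmul_comm _ _

theorem E1.cpow_iinv_cmul (u : Tm) : ∀ n : ℕ,
    E1 (.cmul (cpow (.iinv u) (n + 1)) u) (cpow (.iinv u) n)
  | 0 => (E1.cmul_comm _ _).trans (E1.cmul_iinv u)
  | _ + 1 =>
    (E1.cmul_comm _ _).trans <| (E1.cmul_assoc _ _ _).symm.trans <|
      (E1.cmul_congr (E1.cmul_iinv u) (E1.refl _)).trans <|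
        (E1.cmul_comm _ _).trans (E1.cmul_one _)

theorem odot_natCast (u : Tm) (n : ℕ) : odot n u = cpow u n := by
  cases n <;> simp [odot, cpow]

theorem odot_neg_natCast (u : Tm) (n : ℕ) : odot (-n) u = cpow (.iinv u) n := by
  simp [odot]

theorem E1.odot_cmul (u : Tm) (k : ℤ) : E1 (.cmul (odot k u) u) (odot (k + 1) u) := by
  rcases lt_or_ge k 0 with hk | hk
  · obtain ⟨n, rfl⟩ : ∃ n : ℕ, k = -((n + 1 : ℕ) : ℤ) := ⟨(-k - 1).toNat, by omega⟩
    rw [odot_neg_natCast, show -((n + 1 : ℕ) : ℤ) + 1 = -(n : ℤ) by omega, odot_neg_natCast]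
    exact E1.cpow_iinv_cmul u n
  · lift k to ℕ using hk
    rw [odot_natCast, ← Nat.cast_succ, odot_natCast]
    exact E1.cpow_cmul u k

theorem exists_div_map_eq_div {G : Type*} [CommGroup G] (φ : G →* G) (γ : ℤ → G)
    (hγ : ∀ k, φ (γ k) = γ (k + 1)) (m n : ℤ) : ∃ t, t / φ t = γ m / γ n := by
  induction m using Int.inductionOn' (b := n) with
  | zero => exact ⟨1, by simp⟩
  | succ k _ ih =>
    obtain ⟨t, ht⟩ := ih
    refine ⟨t / γ k, ?_⟩
    rw [map_div, hγ, div_div_div_comm, ht]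
    simp
  | pred k _ ih =>
    obtain ⟨t, ht⟩ := ih
    refine ⟨γ (k - 1) * t, ?_⟩
    rw [map_mul, hγ, mul_div_mul_comm, ht]
    simp

/-- For all integers `m`, `n`, the equation
`x * g(⊙ₙ(b)) =_{E₁} exp(x, b) * g(⊙ₘ(b))` is solvable. -/
theorem solvable_shift_equation (m n : ℤ) :
    ∃ t : Tm, E1 (.mul t (.g (odot n .b))) (.mul (.exp t .b) (.g (odot m .b))) := by
  obtain ⟨q, hq⟩ := exists_div_map_eq_div (E1Quotient.expHom .b)
    (fun k => Quotient.mk _ (.g (odot k .b)))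
    (fun k => Quotient.sound ((E1.exp_g _ _).trans (E1.g_congr (E1.odot_cmul _ k)))) m n
  rw [div_eq_div_iff_mul_eq_mul] at hq
  obtain ⟨t, rfl⟩ := Quotient.exists_rep q
  exact ⟨t, (Quotient.exact hq).trans (E1.mul_comm _ _)⟩
end

section
/- Let m be an integer and let t_x, t_y be ground terms such that t_x * g(t_y) =_{E₁} exp(t_x, b) * g(⊙ₘ(b)). Then there exists an integer n with t_y =_{E₁} ⊙ₙ(b); moreover, if n > m then t_x =_{E₁} g(⊙_{n-1}(b)) * g(⊙_{n-2}(b)) * ⋯ * g(⊙ₘ(b)), and if n < m then t_x =_{E₁} (g(⊙ₙ(b)) * g(⊙_{n+1}(b)) * ⋯ * g(⊙_{m-1}(b)))⁻¹. -/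
/-- `prodG lo len` is the product `g(⊙_{lo+len-1}(b)) * ⋯ * g(⊙_{lo+1}(b)) * g(⊙_{lo}(b))`
of `len` factors; the empty product is `1`. -/
def prodG (lo : ℤ) : ℕ → Tm
  | 0 => .one
  | 1 => .g (odot lo .b)
  | n + 2 => .mul (.g (odot (lo + (n + 1)) .b)) (prodG lo (n + 1))

/-- Terms modulo `E1`. The operation `*` is written additively and `⊛` multiplicatively. -/
def E1Quot : Type := Quotient E1.setoid

namespace E1Quot

/-- The class of a term. -/
def mk (t : Tm) : E1Quot := Quotient.mk E1.setoid t

theorem mk_eq_mk {s t : Tm} : mk s = mk t ↔ E1 s t :=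
  ⟨fun h => Quotient.exact h, fun h => Quotient.sound h⟩

theorem mk_surjective : Function.Surjective mk := Quotient.mk_surjective

instance : Add E1Quot := ⟨Quotient.map₂ Tm.mul fun _ _ h _ _ h' => E1.mul_congr h h'⟩
instance : Zero E1Quot := ⟨mk .one⟩
instance : Neg E1Quot := ⟨Quotient.map Tm.inv fun _ _ h => E1.inv_congr h⟩

instance : AddCommGroup E1Quot where
  nsmul := nsmulRec
  zsmul := zsmulRec
  add_assoc := by
    rintro ⟨x⟩ ⟨y⟩ ⟨z⟩
    exact mk_eq_mk.2 (.mul_assoc x y z)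
  zero_add := by
    rintro ⟨x⟩
    exact mk_eq_mk.2 (.trans (.mul_comm _ _) (.mul_one x))
  add_zero := by
    rintro ⟨x⟩
    exact mk_eq_mk.2 (.mul_one x)
  neg_add_cancel := by
    rintro ⟨x⟩
    exact mk_eq_mk.2 (.trans (.mul_comm _ _) (.mul_inv x))
  add_comm := by
    rintro ⟨x⟩ ⟨y⟩
    exact mk_eq_mk.2 (.mul_comm x y)

instance : Mul E1Quot := ⟨Quotient.map₂ Tm.cmul fun _ _ h _ _ h' => E1.cmul_congr h h'⟩
instance : One E1Quot := ⟨mk .one⟩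
instance : Inv E1Quot := ⟨Quotient.map Tm.iinv fun _ _ h => E1.iinv_congr h⟩

instance : CommGroup E1Quot where
  mul_assoc := by
    rintro ⟨x⟩ ⟨y⟩ ⟨z⟩
    exact mk_eq_mk.2 (.cmul_assoc x y z)
  one_mul := by
    rintro ⟨x⟩
    exact mk_eq_mk.2 (.trans (.cmul_comm _ _) (.cmul_one x))
  mul_one := by
    rintro ⟨x⟩
    exact mk_eq_mk.2 (.cmul_one x)
  inv_mul_cancel := by
    rintro ⟨x⟩
    exact mk_eq_mk.2 (.trans (.cmul_comm _ _) (.cmul_iinv x))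
  mul_comm := by
    rintro ⟨x⟩ ⟨y⟩
    exact mk_eq_mk.2 (.cmul_comm x y)

/-- Exponentiation by `u`, a homomorphism for `*`. -/
def expHom (u : E1Quot) : E1Quot →+ E1Quot where
  toFun x := Quotient.map₂ Tm.exp (fun _ _ h _ _ h' => E1.exp_congr h h') x u
  map_zero' := by
    rcases u with ⟨u⟩
    exact mk_eq_mk.2 (.one_exp u)
  map_add' := by
    rcases u with ⟨u⟩
    rintro ⟨x⟩ ⟨y⟩
    exact mk_eq_mk.2 (.exp_mul x y u)

/-- The operation induced by `g`. -/
def gMap : E1Quot → E1Quot := Quotient.map Tm.g fun _ _ h => E1.g_congr h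

theorem mk_one : mk .one = 0 := rfl
theorem mk_one' : mk .one = 1 := rfl
theorem one_eq_zero : (1 : E1Quot) = 0 := rfl
theorem mk_mul (s t : Tm) : mk (.mul s t) = mk s + mk t := rfl
theorem mk_inv (t : Tm) : mk (.inv t) = -mk t := rfl
theorem mk_cmul (s t : Tm) : mk (.cmul s t) = mk s * mk t := rfl
theorem mk_iinv (t : Tm) : mk (.iinv t) = (mk t)⁻¹ := rfl
theorem mk_exp (s t : Tm) : mk (.exp s t) = expHom (mk t) (mk s) := rfl
theorem mk_g (t : Tm) : mk (.g t) = gMap (mk t) := rfl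

theorem expHom_one (x : E1Quot) : expHom 1 x = x := by
  rcases x with ⟨x⟩
  exact mk_eq_mk.2 (.exp_one x)

theorem expHom_gMap (u x : E1Quot) : expHom u (gMap x) = gMap (x * u) := by
  rcases x with ⟨x⟩
  rcases u with ⟨u⟩
  exact mk_eq_mk.2 (.exp_g x u)

theorem mk_cpow (u : Tm) : ∀ k : ℕ, mk (cpow u k) = mk u ^ k
  | 0 => by simp [cpow, mk_one']
  | 1 => by simp [cpow]
  | k + 2 => by rw [cpow, mk_cmul, mk_cpow u (k + 1), ← pow_succ']

theorem mk_odot (n : ℤ) (u : Tm) : mk (odot n u) = mk u ^ n := by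
  unfold odot
  split_ifs with h
  · rw [mk_cpow, ← zpow_natCast, Int.toNat_of_nonneg h.le]
  · rw [mk_cpow, mk_iinv, ← zpow_natCast, Int.toNat_of_nonneg (by lia), inv_zpow', neg_neg]

theorem mk_prodG_succ (lo : ℤ) :
    ∀ k : ℕ, mk (prodG lo (k + 1)) = gMap (mk .b ^ (lo + k)) + mk (prodG lo k)
  | 0 => by simp [prodG, mk_g, mk_odot, mk_one]
  | k + 1 => by simp [prodG, mk_g, mk_odot, mk_mul]

theorem expHom_prodG (lo : ℤ) (k : ℕ) :
    expHom (mk .b) (mk (prodG lo k)) + gMap (mk .b ^ lo) =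
      mk (prodG lo k) + gMap (mk .b ^ (lo + k)) := by
  induction k with
  | zero => simp [prodG, mk_one]
  | succ k ih =>
    have hk : mk .b ^ (lo + k) * mk .b = mk .b ^ (lo + (k + 1 : ℕ)) := by
      rw [← zpow_add_one, Nat.cast_succ, add_assoc]
    rw [mk_prodG_succ, map_add, expHom_gMap, hk, add_assoc, ih]
    abel

/-- The number of occurrences of `b` outside exponents and outside `g`, counted with sign. -/
def bCount : Tm → ℤ
  | .b => 1
  | .var _ => 0
  | .c => 0
  | .one => 0
  | .mul s t => bCount s + bCount t
  | .cmul s t => bCount s + bCount t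
  | .exp s _ => bCount s
  | .inv t => -bCount t
  | .iinv t => -bCount t
  | .g _ => 0

theorem bCount_eq_of_E1 {s t : Tm} (h : E1 s t) : bCount s = bCount t := by
  induction h <;> (try simp only [bCount] at *) <;> lia

/-- `bCount` as a homomorphism for `⊛`. -/
def bCountHom : E1Quot →* Multiplicative ℤ where
  toFun := Quotient.lift (fun t => Multiplicative.ofAdd (bCount t))
    fun _ _ h => congrArg _ (bCount_eq_of_E1 h)
  map_one' := rfl
  map_mul' := by
    rintro ⟨x⟩ ⟨y⟩
    rfl

theorem mk_b_pow_injective : Function.Injective fun k : ℕ => mk .b ^ k := by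
  intro j k h
  have hb : bCountHom (mk .b) = Multiplicative.ofAdd 1 := rfl
  have h' := congrArg (fun q => Multiplicative.toAdd (bCountHom q)) h
  simpa [hb] using h'

theorem mk_b_ne_one : mk .b ≠ 1 := by
  intro h
  have := @mk_b_pow_injective 1 0 (by simpa using h)
  lia

/-- Formal generators for the group `(*, ⁻¹, 1)`: `Sum.inl q` stands for `g(q)`, and
`Sum.inr (q, [u₁, …, uₖ])` stands for `exp(⋯ exp(q, uₖ) ⋯, u₁)`. -/
abbrev Atom : Type := E1Quot ⊕ (E1Quot × List E1Quot)

/-- The class denoted by an atom. -/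
def Atom.val : Atom → E1Quot
  | .inl q => gMap q
  | .inr (q, l) => l.foldr (fun u x => expHom u x) q

open Classical in
/-- Exponentiation by `u` on atoms. -/
noncomputable def Atom.shift (u : E1Quot) : Atom → Atom
  | .inl q => .inl (q * u)
  | .inr (q, l) => .inr (q, if u = 1 then l else u :: l)

theorem Atom.val_shift (u : E1Quot) (a : Atom) : (a.shift u).val = expHom u a.val := by
  rcases a with q | ⟨q, l⟩
  · exact (expHom_gMap u q).symm
  · by_cases hu : u = 1
    · simp [Atom.shift, hu, expHom_one]
    · simp [Atom.shift, Atom.val, hu]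

theorem Atom.shift_one (a : Atom) : a.shift 1 = a := by
  rcases a with q | ⟨q, l⟩ <;> simp [Atom.shift]

theorem Atom.shift_injective (u : E1Quot) : Function.Injective (Atom.shift u) := by
  rintro (q | ⟨q, l⟩) (q' | ⟨q', l'⟩) h <;> simp only [Atom.shift] at h
  · simpa using h
  · cases h
  · cases h
  · by_cases hu : u = 1 <;> simpa [hu] using h

theorem Atom.iterate_shift_b_injective (a : Atom) :
    Function.Injective fun k : ℕ => (Atom.shift (mk .b))^[k] a := by
  rcases a with q | ⟨q, l⟩
  · have h : ∀ k : ℕ, (Atom.shift (mk .b))^[k] (.inl q) = .inl (q * mk .b ^ k) := by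
      intro k
      induction k with
      | zero => simp
      | succ k ih => rw [Function.iterate_succ_apply', ih, Atom.shift, pow_succ, mul_assoc]
    intro j k hjk
    simp only [h, Sum.inl.injEq, mul_right_inj] at hjk
    exact mk_b_pow_injective hjk
  · have h : ∀ k : ℕ, (Atom.shift (mk .b))^[k] (.inr (q, l)) =
        .inr (q, List.replicate k (mk .b) ++ l) := by
      intro k
      induction k with
      | zero => simp
      | succ k ih =>
        rw [Function.iterate_succ_apply', ih, Atom.shift, if_neg mk_b_ne_one]
        rfl
    intro j k hjk
    simp only [h, Sum.inr.injEq, Prod.mk.injEq] at hjk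
    simpa using congrArg List.length hjk.2

/-- The class denoted by a formal sum of atoms. -/
noncomputable def eval : (Atom →₀ ℤ) →+ E1Quot :=
  Finsupp.liftAddHom fun a => zmultiplesHom E1Quot a.val

/-- Exponentiation by `u` on formal sums of atoms. -/
noncomputable def act (u : E1Quot) : (Atom →₀ ℤ) →+ (Atom →₀ ℤ) :=
  Finsupp.mapDomain.addMonoidHom (Atom.shift u)

theorem eval_single (a : Atom) : eval (Finsupp.single a 1) = a.val := by
  simp [eval]

theorem act_single (u : E1Quot) (a : Atom) (k : ℤ) :
    act u (Finsupp.single a k) = Finsupp.single (a.shift u) k :=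
  Finsupp.mapDomain_single

theorem act_one (n : Atom →₀ ℤ) : act 1 n = n := by
  have h : Atom.shift 1 = id := funext Atom.shift_one
  simp [act, h]

theorem eval_act (u : E1Quot) (n : Atom →₀ ℤ) : eval (act u n) = expHom u (eval n) := by
  suffices h : eval.comp (act u) = (expHom u).comp eval from DFunLike.congr_fun h n
  ext a
  simp [act_single, eval_single, Atom.val_shift]

open Classical in
/-- A section of `eval` sending the unit to `0`. -/
noncomputable def lift (q : E1Quot) : Atom →₀ ℤ :=
  if q = 0 then 0 else Finsupp.single (.inr (q, [])) 1

theorem lift_zero : lift 0 = 0 := if_pos rfl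

theorem eval_lift (q : E1Quot) : eval (lift q) = q := by
  unfold lift
  split_ifs with h
  · simp [h]
  · simp [eval_single, Atom.val]

/-- An interpretation of terms as formal sums of atoms. The operation `⊛` is transported from the
product of `(E1Quot, ⊛)` with the kernel of `eval` along the section `lift`. -/
noncomputable def decomp : Tm → Atom →₀ ℤ
  | .var k => lift (mk (.var k))
  | .b => lift (mk .b)
  | .c => lift (mk .c)
  | .one => 0
  | .mul s t => decomp s + decomp t
  | .cmul s t => lift (mk (.cmul s t)) + (decomp s - lift (mk s)) + (decomp t - lift (mk t))
  | .exp s t => act (mk t) (decomp s)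
  | .inv t => -decomp t
  | .iinv t => lift (mk (.iinv t)) - (decomp t - lift (mk t))
  | .g t => Finsupp.single (.inl (mk t)) 1

theorem eval_decomp (t : Tm) : eval (decomp t) = mk t := by
  induction t <;>
    simp_all [decomp, eval_lift, eval_act, eval_single, Atom.val, mk_one, mk_mul, mk_inv, mk_exp,
      mk_g]

theorem decomp_eq_of_E1 {s t : Tm} (h : E1 s t) : decomp s = decomp t := by
  induction h with
  | mul_assoc x y z => exact add_assoc _ _ _
  | mul_comm x y => exact add_comm _ _
  | cmul_assoc x y z =>
    simp only [decomp, mk_cmul, mul_assoc]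
    abel
  | cmul_comm x y =>
    simp only [decomp, mk_cmul, mul_comm (mk x)]
    abel
  | mul_inv x => exact add_neg_cancel _
  | mul_one x => exact add_zero _
  | cmul_iinv x =>
    simp only [decomp, mk_cmul, mk_iinv, mul_inv_cancel, one_eq_zero, lift_zero]
    abel
  | cmul_one x =>
    simp only [decomp, mk_cmul, mk_one', mul_one]
    rw [one_eq_zero, lift_zero]
    abel
  | exp_one x => exact act_one _
  | one_exp z => exact map_zero _
  | exp_inv x z => exact map_neg _ _
  | exp_g x y => exact act_single _ _ _
  | exp_mul x y z => exact map_add _ _ _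
  | refl t => rfl
  | symm _ ih => exact ih.symm
  | trans _ _ ih ih' => exact ih.trans ih'
  | mul_congr _ _ ih ih' => simp only [decomp, ih, ih']
  | cmul_congr h h' ih ih' =>
    simp only [decomp, mk_cmul, ih, ih', mk_eq_mk.2 h, mk_eq_mk.2 h']
  | exp_congr _ h' ih _ => simp only [decomp, ih, mk_eq_mk.2 h']
  | inv_congr _ ih => simp only [decomp, ih]
  | iinv_congr h ih => simp only [decomp, mk_iinv, ih, mk_eq_mk.2 h]
  | g_congr h _ => simp only [decomp, mk_eq_mk.2 h]

theorem _root_.Finsupp.eq_zero_of_mapDomain_eq_self {α M : Type*} [AddCommMonoid M] {f : α → α}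
    (hf : Function.Injective f) (hiter : ∀ a, Function.Injective fun k : ℕ => f^[k] a)
    {n : α →₀ M} (h : n.mapDomain f = n) : n = 0 := by
  ext a
  by_contra ha
  have hconst : ∀ k : ℕ, n (f^[k] a) = n a := by
    intro k
    induction k with
    | zero => rfl
    | succ k ih =>
      rw [Function.iterate_succ_apply', ← ih]
      conv_lhs => rw [← h]
      exact Finsupp.mapDomain_apply hf _ _
  refine Set.infinite_of_injective_forall_mem (hiter a) (fun k => ?_) n.support.finite_toSet
  simpa [hconst k] using ha

theorem eq_zero_of_expHom_b_eq_self {x : E1Quot} (h : expHom (mk .b) x = x) : x = 0 := by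
  obtain ⟨t, rfl⟩ := mk_surjective x
  have ht : act (mk .b) (decomp t) = decomp t := decomp_eq_of_E1 (mk_eq_mk.1 h)
  rw [← eval_decomp, Finsupp.eq_zero_of_mapDomain_eq_self (Atom.shift_injective _)
    Atom.iterate_shift_b_injective ht, map_zero]

open Classical in
/-- The total coefficient of the atoms `g(q)` with `q` a `⊛`-power of `b`. -/
noncomputable def bPowCoeff : (Atom →₀ ℤ) →+ ℤ :=
  Finsupp.liftAddHom fun a => zmultiplesHom ℤ
    (Sum.elim (fun q => if q ∈ Subgroup.zpowers (mk .b) then 1 else 0) (fun _ => 0) a)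

theorem bPowCoeff_act_b (n : Atom →₀ ℤ) : bPowCoeff (act (mk .b) n) = bPowCoeff n := by
  suffices h : bPowCoeff.comp (act (mk .b)) = bPowCoeff from DFunLike.congr_fun h n
  ext (q | ⟨q, l⟩)
  · simp [act_single, bPowCoeff, Atom.shift,
      Subgroup.mul_mem_cancel_right _ (Subgroup.mem_zpowers (mk .b))]
  · simp [act_single, bPowCoeff, Atom.shift]

theorem mem_zpowers_b_of_E1 {m : ℤ} {s t : Tm}
    (h : E1 (.mul s (.g t)) (.mul (.exp s .b) (.g (odot m .b)))) :
    mk t ∈ Subgroup.zpowers (mk .b) := by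
  have h' := congrArg bPowCoeff (decomp_eq_of_E1 h)
  simp only [decomp, map_add, bPowCoeff_act_b, add_right_inj, mk_odot] at h'
  by_contra ht
  simp [bPowCoeff, ht] at h'

end E1Quot

open E1Quot in
/-- Every ground solution of `x * g(y) =_{E₁} exp(x, b) * g(⊙ₘ(b))` has
`y =_{E₁} ⊙ₙ(b)` for some integer `n`; moreover if `n > m` then
`x =_{E₁} g(⊙_{n-1}(b)) * ⋯ * g(⊙ₘ(b))`, and if `n < m` then
`x =_{E₁} (g(⊙ₙ(b)) * ⋯ * g(⊙_{m-1}(b)))⁻¹`. -/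
theorem ground_solutions_classified (m : ℤ) (tx ty : Tm)
    (hx : tx.Ground) (hy : ty.Ground)
    (h : E1 (.mul tx (.g ty)) (.mul (.exp tx .b) (.g (odot m .b)))) :
    ∃ n : ℤ, E1 ty (odot n .b) ∧
      (m < n → E1 tx (prodG m (n - m).toNat)) ∧
      (n < m → E1 tx (.inv (prodG n (m - n).toNat))) := by
  obtain ⟨n, hn⟩ := mem_zpowers_b_of_E1 h
  replace hn : mk .b ^ n = mk ty := hn
  have hX : mk tx + gMap (mk .b ^ n) = expHom (mk .b) (mk tx) + gMap (mk .b ^ m) := by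
    have := mk_eq_mk.2 h
    rwa [mk_mul, mk_mul, mk_exp, mk_g, mk_g, mk_odot, ← hn] at this
  refine ⟨n, mk_eq_mk.1 (by rw [mk_odot, hn]), fun hmn => mk_eq_mk.1 ?_, fun hnm => mk_eq_mk.1 ?_⟩
  · have hP := expHom_prodG m (n - m).toNat
    rw [show m + ((n - m).toNat : ℤ) = n by lia] at hP
    refine sub_eq_zero.1 (eq_zero_of_expHom_b_eq_self ?_)
    rw [map_sub, eq_sub_of_add_eq hX.symm, eq_sub_of_add_eq hP]
    abel
  · have hP := expHom_prodG n (m - n).toNat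
    rw [show n + ((m - n).toNat : ℤ) = m by lia] at hP
    rw [mk_inv]
    refine eq_neg_of_add_eq_zero_left (eq_zero_of_expHom_b_eq_self ?_)
    rw [map_add, eq_sub_of_add_eq hX.symm, eq_sub_of_add_eq hP]
    abel
end

section
/- Let j be an integer and let t_x, t_z, t_u be ground terms satisfying the two equations exp(t_x, c) * g(⊙ⱼ(b)) =_{E₁} exp(t_x, b) * g(t_u) and t_z * g(t_u) =_{E₁} exp(t_z, c) * g(1). Then t_u =_{E₁} ⊙ⱼ(c). -/
/-- The abelian group of terms modulo `E₁` under the operation `⊛`. -/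
def CGroup : Type := Quotient E1.setoid

namespace CGroup

/-- The class of a term modulo `E₁`. -/
def mk (t : Tm) : CGroup := Quotient.mk E1.setoid t

theorem mk_eq_mk {s t : Tm} : mk s = mk t ↔ E1 s t :=
  ⟨fun h => Quotient.exact h, fun h => Quotient.sound h⟩

instance : CommGroup CGroup where
  mul := Quotient.map₂ Tm.cmul fun _ _ h _ _ k => E1.cmul_congr h k
  one := mk .one
  inv := Quotient.map Tm.iinv fun _ _ h => E1.iinv_congr h
  mul_assoc := by
    rintro ⟨x⟩ ⟨y⟩ ⟨z⟩
    exact mk_eq_mk.2 (E1.cmul_assoc x y z)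
  mul_comm := by
    rintro ⟨x⟩ ⟨y⟩
    exact mk_eq_mk.2 (E1.cmul_comm x y)
  one_mul := by
    rintro ⟨x⟩
    exact mk_eq_mk.2 ((E1.cmul_comm _ _).trans (E1.cmul_one x))
  mul_one := by
    rintro ⟨x⟩
    exact mk_eq_mk.2 (E1.cmul_one x)
  inv_mul_cancel := by
    rintro ⟨x⟩
    exact mk_eq_mk.2 ((E1.cmul_comm _ _).trans (E1.cmul_iinv x))

theorem mk_one : mk .one = 1 := rfl

theorem mk_cmul (s t : Tm) : mk (.cmul s t) = mk s * mk t := rfl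

theorem mk_iinv (t : Tm) : mk (.iinv t) = (mk t)⁻¹ := rfl

theorem mk_cpow (u : Tm) : ∀ n : ℕ, mk (cpow u n) = mk u ^ n
  | 0 => by rw [cpow, mk_one, pow_zero]
  | 1 => by rw [cpow, pow_one]
  | n + 2 => by rw [cpow, mk_cmul, mk_cpow u (n + 1), ← pow_succ']

theorem mk_odot (n : ℤ) (u : Tm) : mk (odot n u) = mk u ^ n := by
  unfold odot
  split_ifs with h
  · rw [mk_cpow, ← zpow_natCast, Int.toNat_of_nonneg h.le]
  · rw [mk_cpow, mk_iinv, ← zpow_natCast, Int.toNat_of_nonneg (by omega), inv_zpow', neg_neg]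

end CGroup

/-- The total degree of a term in `b` and `c`, where `g` has degree zero and exponents are
ignored. -/
def Tm.degree : Tm → ℤ
  | .var _ => 0
  | .b => 1
  | .c => 1
  | .one => 0
  | .mul s t => s.degree + t.degree
  | .cmul s t => s.degree + t.degree
  | .exp s _ => s.degree
  | .inv t => -t.degree
  | .iinv t => -t.degree
  | .g _ => 0

theorem E1.degree_eq {s t : Tm} (h : E1 s t) : s.degree = t.degree := by
  induction h <;> grind [Tm.degree]

/-- The degree as a homomorphism on the `⊛`-group. -/
def CGroup.degree : CGroup →* Multiplicative ℤ where
  toFun := Quotient.lift (fun t => Multiplicative.ofAdd t.degree)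
    fun _ _ h => congrArg _ (E1.degree_eq h)
  map_one' := rfl
  map_mul' := by
    rintro ⟨x⟩ ⟨y⟩
    rfl

/-- The value of a term in a commutative ring in which `*` and `⊛` are both read as addition,
`g` as a multiplicative character `φ` of the `⊛`-group, and `exp` as multiplication by `φ`. -/
def Tm.eval {R : Type*} [CommRing R] (φ : CGroup →* R) : Tm → R
  | .var _ => 0
  | .b => 0
  | .c => 0
  | .one => 0
  | .mul s t => s.eval φ + t.eval φ
  | .cmul s t => s.eval φ + t.eval φ
  | .exp s t => s.eval φ * φ (CGroup.mk t)
  | .inv t => -t.eval φ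
  | .iinv t => -t.eval φ
  | .g t => φ (CGroup.mk t)

theorem E1.eval_eq {R : Type*} [CommRing R] (φ : CGroup →* R) {s t : Tm} (h : E1 s t) :
    s.eval φ = t.eval φ := by
  induction h with
  | exp_congr _ hu ih _ => simp only [Tm.eval, ih, CGroup.mk_eq_mk.2 hu]
  | g_congr hs _ => simp only [Tm.eval, CGroup.mk_eq_mk.2 hs]
  | symm _ ih => exact ih.symm
  | trans _ _ ih₁ ih₂ => exact ih₁.trans ih₂
  | _ => simp_all only [Tm.eval, CGroup.mk_one, CGroup.mk_cmul, map_one, map_mul] <;> ring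

/-- The character of the `⊛`-group with values in the group ring of `H` induced by a
homomorphism to `H`. -/
noncomputable def CGroup.character {H : Type*} [CommGroup H] (f : CGroup →* H) :
    CGroup →* MonoidAlgebra ℤ H :=
  (MonoidAlgebra.of ℤ H).comp f

theorem CGroup.character_eq_iff {H : Type*} [CommGroup H] (f : CGroup →* H) {x y : CGroup} :
    character f x = character f y ↔ f x = f y :=
  MonoidAlgebra.of_injective.eq_iff

/-- If ground terms `t_x`, `t_z`, `t_u` satisfy
`exp(t_x, c) * g(⊙ⱼ(b)) =_{E₁} exp(t_x, b) * g(t_u)` and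
`t_z * g(t_u) =_{E₁} exp(t_z, c) * g(1)`, then `t_u =_{E₁} ⊙ⱼ(c)`. -/
theorem copy_equations_force_value (j : ℤ) (tx tz tu : Tm)
    (hx : tx.Ground) (hz : tz.Ground) (hu : tu.Ground)
    (h1 : E1 (.mul (.exp tx .c) (.g (odot j .b))) (.mul (.exp tx .b) (.g tu)))
    (h2 : E1 (.mul tz (.g tu)) (.mul (.exp tz .c) (.g .one))) :
    E1 tu (odot j .c) := by
  have hdeg : CGroup.degree (CGroup.mk tu) = CGroup.degree (CGroup.mk .b) ^ j := by
    have h := h1.eval_eq (CGroup.character CGroup.degree)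
    have hbc : CGroup.character CGroup.degree (CGroup.mk .c) =
        CGroup.character CGroup.degree (CGroup.mk .b) :=
      (CGroup.character_eq_iff _).2 rfl
    simp only [Tm.eval, hbc, add_right_inj] at h
    rw [← map_zpow, ← CGroup.mk_odot, ← (CGroup.character_eq_iff _).1 h]
  have hgen : CGroup.degree (CGroup.mk .c) = Multiplicative.ofAdd 1 ∧
      CGroup.degree (CGroup.mk .b) = Multiplicative.ofAdd 1 := ⟨rfl, rfl⟩
  obtain ⟨k, hk⟩ : CGroup.mk tu ∈ Subgroup.zpowers (CGroup.mk .c) := by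
    set q := QuotientGroup.mk' (Subgroup.zpowers (CGroup.mk .c))
    have h := h2.eval_eq (CGroup.character q)
    have hc : CGroup.character q (CGroup.mk .c) = 1 := by
      rw [← map_one (CGroup.character q), CGroup.character_eq_iff, map_one]
      exact (QuotientGroup.eq_one_iff _).2 (Subgroup.mem_zpowers _)
    simp only [Tm.eval, hc, mul_one, add_right_inj] at h
    rw [CGroup.character_eq_iff, CGroup.mk_one, map_one] at h
    exact (QuotientGroup.eq_one_iff _).1 h
  have hkj : k = j := by
    simp only [← hk, map_zpow, hgen.1, hgen.2] at hdeg
    simpa using congrArg Multiplicative.toAdd hdeg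
  rw [← CGroup.mk_eq_mk, CGroup.mk_odot, ← hkj]
  exact hk.symm
end
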